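/- arXiv:1804.02711 — 2 statements merged into one kernel-verified Lean document; each statement's English description precedes it below -/
import Mathlib

section
/- Let G = (V, E) be a chordal graph on vertex set V = {1, ..., r} with maximal cliques C_1, ..., C_t. A symmetric real matrix X in S^r(E, 0) is positive semidefinite (i.e., X ∈ S^r_+(E, 0)) if and only if there exist positive semidefinite matrices X_k ∈ S^{|C_k|}_+, for k = 1, ..., t, such that X = Σ_{k=1}^{t} E_{C_k}^T X_k E_{C_k}. -/
open Matrix

/-- A graph is chordal if every cycle of length at least 4 has a chord,
i.e. an edge joining two nonconsecutive nodes of the cycle. -/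
def IsChordalGraph {V : Type*} (G : SimpleGraph V) : Prop :=
  ∀ (k : ℕ), 4 ≤ k → ∀ v : ZMod k → V, Function.Injective v →
    (∀ i, G.Adj (v i) (v (i + 1))) →
    ∃ i j : ZMod k, i ≠ j ∧ j ≠ i + 1 ∧ i ≠ j + 1 ∧ G.Adj (v i) (v j)

/-- A maximal clique: a clique not contained in any other clique. -/
def IsMaxClique {V : Type*} (G : SimpleGraph V) (s : Finset V) : Prop :=
  G.IsClique ↑s ∧ ∀ t : Finset V, G.IsClique ↑t → s ⊆ t → s = t

/-- The 0/1 index matrix `E_C` of a vertex subset `C ⊆ {1,…,r}`: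
`(E_C)_{ij} = 1` iff the `i`-th element of `C` (in the natural order) equals `j`. -/
def indexMatrix {r : ℕ} (R : Type*) [Zero R] [One R] (C : Finset (Fin r)) :
    Matrix (Fin C.card) (Fin r) R :=
  Matrix.of fun i j => if ((C.orderIsoOfFin rfl i : Fin r) = j) then 1 else 0

/-- a path of length `n` from `a` to `b` with interior vertices in `T`. -/
def IPath {V : Type*} (G : SimpleGraph V) (T : Set V) (a b : V) (n : ℕ) (f : ℕ → V) : Prop :=
  f 0 = a ∧ f n = b ∧ (∀ i, i < n → G.Adj (f i) (f (i + 1))) ∧ ∀ i, 0 < i → i < n → f i ∈ T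

theorem ipath_of_reach {V : Type*} (G : SimpleGraph V) (T : Set V) {y z : V}
    (h : Relation.ReflTransGen (fun u v => G.Adj u v ∧ u ∈ T ∧ v ∈ T) y z) :
    ∃ n f, IPath G T y z n f := by
  induction h with
  | refl => exact ⟨0, fun _ => y, rfl, rfl, by simp, by omega⟩
  | @tail u w _ h ih =>
    obtain ⟨n, f, h0, hn, ha, hT⟩ := ih
    refine ⟨n + 1, fun k => if k ≤ n then f k else w, by simpa, by simp, ?_, ?_⟩
    · intro i hi
      by_cases hin : i = n
      · subst hin; simpa [hn] using h.1
      · have h1 : i ≤ n := by omega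
        have h2 : i + 1 ≤ n := by omega
        simpa [h1, h2] using ha i (by omega)
    · intro i hi hin
      have h1 : i ≤ n := by omega
      by_cases hin : i = n
      · subst hin; simpa [hn] using h.2.1
      · simpa [h1] using hT i hi (by omega)

theorem ipath_extend {V : Type*} (G : SimpleGraph V) (T : Set V) {a b y z : V}
    (hay : G.Adj a y) (hzb : G.Adj z b) (hy : y ∈ T) (hz : z ∈ T)
    (h : ∃ n f, IPath G T y z n f) : ∃ n f, IPath G T a b n f := by
  obtain ⟨n, f, h0, hn, ha, hT⟩ := h
  refine ⟨n + 2, fun k => if k = 0 then a else if k ≤ n + 1 then f (k - 1) else b,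
    by simp, by simp, ?_, ?_⟩
  · intro i hi
    rcases Nat.eq_zero_or_pos i with rfl | hp
    · simpa [h0] using hay
    · obtain ⟨i, rfl⟩ : ∃ j, i = j + 1 := ⟨i - 1, by omega⟩
      by_cases hin : i = n
      · subst hin; simpa [hn] using hzb
      · have h1 : i ≤ n := by omega
        have h2 : i + 1 ≤ n := by omega
        simpa [h1, h2] using ha i (by omega)
  · intro i hi hin
    obtain ⟨i, rfl⟩ : ∃ j, i = j + 1 := ⟨i - 1, by omega⟩
    have h1 : i ≤ n := by omega
    have : f i ∈ T := by
      rcases Nat.eq_zero_or_pos i with rfl | hp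
      · rwa [h0]
      · by_cases hin : i = n
        · subst hin; rwa [hn]
        · exact hT i hp (by omega)
    simpa [h1] using this

/-- shortcut: skipping `d` indices after `i`. -/
theorem ipath_shortcut {V : Type*} (G : SimpleGraph V) (T : Set V) {a b : V} {n : ℕ} {f : ℕ → V}
    (h : IPath G T a b n f) (i d : ℕ) (hid : i + 1 + d ≤ n) (hadj : G.Adj (f i) (f (i + 1 + d))) :
    ∃ f', IPath G T a b (n - d) f' := by
  obtain ⟨h0, hn, ha, hT⟩ := h
  refine ⟨fun k => if k ≤ i then f k else f (k + d), by simpa, ?_, ?_, ?_⟩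
  · have h1 : ¬ (n - d ≤ i) := by omega
    have h2 : n - d + d = n := by omega
    simp [h1, h2, hn]
  · intro k hk
    rcases lt_trichotomy k i with h | h | h
    · simpa [h.le, Nat.succ_le_of_lt h] using ha k (by omega)
    · subst h; simpa using hadj
    · have h1 : ¬ k ≤ i := by omega
      have h2 : ¬ k + 1 ≤ i := by omega
      simpa [h1, h2, add_right_comm] using ha (k + d) (by omega)
  · intro k hk hkn
    by_cases h1 : k ≤ i
    · simpa [h1] using hT k hk (by omega)
    · simpa [h1] using hT (k + d) (by omega) (by omega)

theorem chordal_adj {V : Type*} (G : SimpleGraph V) (hG : IsChordalGraph G) (T : Set V)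
    {a b x : V} (hab : a ≠ b) (hxa : G.Adj x a) (hxb : G.Adj x b)
    (hxT : ∀ y ∈ T, y ≠ x ∧ ¬ G.Adj x y) (h : ∃ n f, IPath G T a b n f) : G.Adj a b := by
  classical
  by_contra hnab
  let n := Nat.find h
  obtain ⟨f, hf⟩ : ∃ f, IPath G T a b n f := Nat.find_spec h
  have hmin : ∀ m, m < n → ¬ ∃ f, IPath G T a b m f := fun m hm => Nat.find_min h hm
  clear_value n
  have hshort : ∀ i j, i + 1 < j → j ≤ n → ¬ G.Adj (f i) (f j) := by
    intro i j hij hj hadj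
    refine hmin (n - (j - i - 1)) (by omega) (ipath_shortcut G T hf i (j - i - 1) (by omega) ?_)
    rwa [show i + 1 + (j - i - 1) = j by omega]
  obtain ⟨h0, hn, ha, hT⟩ := id hf
  have hn0 : n ≠ 0 := by rintro rfl; exact hab (h0.symm.trans hn)
  have hn1 : n ≠ 1 := by
    rintro rfl
    apply hnab
    have := ha 0 (by omega)
    rwa [h0, show 0 + 1 = 1 from rfl, hn] at this
  have hinj' : ∀ i j, i < j → j ≤ n → f i ≠ f j := by
    intro i j hij hj he
    by_cases hjn : j = n
    · subst hjn
      rcases Nat.eq_zero_or_pos i with rfl | hp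
      · exact hab (by rw [← h0, ← hn, he])
      · refine hshort (i - 1) j (by omega) le_rfl ?_
        rw [← he]
        have := ha (i - 1) (by omega)
        rwa [show i - 1 + 1 = i by omega] at this
    · refine hshort i (j + 1) (by omega) (by omega) ?_
      rw [he]; exact ha j (by omega)
  have hinj : ∀ i j, i ≤ n → j ≤ n → f i = f j → i = j := by
    intro i j hi hj he
    rcases lt_trichotomy i j with h | h | h
    · exact absurd he (hinj' i j h hj)
    · exact h
    · exact absurd he.symm (hinj' j i h hi)
  have hxf : ∀ i, i ≤ n → f i ≠ x := by
    intro i hi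
    rcases Nat.eq_zero_or_pos i with rfl | hp
    · rw [h0]; exact hxa.ne'
    · by_cases hin : i = n
      · rw [hin, hn]; exact hxb.ne'
      · exact (hxT _ (hT i hp (by omega))).1
  have hxadj : ∀ i, i ≤ n → G.Adj x (f i) → i = 0 ∨ i = n := by
    intro i hi hadj
    by_contra hc
    exact (hxT _ (hT i (by omega) (by omega))).2 hadj
  have hlt : ∀ i : ZMod (n + 2), i.val < n + 2 := fun i => ZMod.val_lt i
  have hval : ∀ i : ZMod (n + 2), (i + 1).val = if i.val = n + 1 then 0 else i.val + 1 := by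
    intro i
    have := hlt i
    rw [ZMod.val_add, ZMod.val_one_eq_one_mod, Nat.mod_eq_of_lt (show 1 < n + 2 by omega)]
    split_ifs with h
    · rw [h]; simp
    · exact Nat.mod_eq_of_lt (by omega)
  obtain ⟨i, j, hij, hj, hi, hadj⟩ := hG (n + 2) (by omega)
    (fun i => if i.val = n + 1 then x else f i.val) (by
      intro i j he
      apply ZMod.val_injective
      have := hlt i
      have := hlt j
      dsimp only at he
      split_ifs at he with h1 h2 h2
      · omega
      · exact absurd he.symm (hxf _ (by omega))
      · exact absurd he (hxf _ (by omega))
      · exact hinj _ _ (by omega) (by omega) he) (by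
      intro i
      have := hlt i
      rw [hval]
      by_cases h1 : i.val = n + 1
      · simpa [h1, h0] using hxa
      · by_cases h2 : i.val = n
        · simpa [h2, hn] using hxb.symm
        · simpa [h1, h2] using ha i.val (by omega))
  have hij' : i.val ≠ j.val := fun h => hij (ZMod.val_injective _ h)
  have hj' : j.val ≠ (i + 1).val := fun h => hj (ZMod.val_injective _ h)
  have hi' : i.val ≠ (j + 1).val := fun h => hi (ZMod.val_injective _ h)
  rw [hval] at hi' hj'
  have l1 := hlt i
  have l2 := hlt j
  generalize i.val = p at *
  generalize j.val = q at *
  split_ifs at hadj hi' hj' with h1 h2 h2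
  · omega
  · rcases hxadj q (by omega) hadj with h | h <;> omega
  · rcases hxadj p (by omega) hadj.symm with h | h <;> omega
  · rcases lt_or_gt_of_ne hij' with h | h
    · exact hshort p q (by omega) (by omega) hadj
    · exact hshort q p (by omega) (by omega) hadj.symm

def Simp {V : Type*} (G : SimpleGraph V) (S : Finset V) (v : V) : Prop :=
  v ∈ S ∧ ∀ a ∈ S, ∀ b ∈ S, G.Adj v a → G.Adj v b → a ≠ b → G.Adj a b

theorem simp_aux {V : Type*} (G : SimpleGraph V) (hG : IsChordalGraph G) (m : ℕ) :
    ∀ S : Finset V, S.card = m →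
      (S.Nonempty → ∃ v, Simp G S v) ∧
      (∀ x ∈ S, (∃ y ∈ S, y ≠ x ∧ ¬ G.Adj x y) → ∃ v, Simp G S v ∧ v ≠ x ∧ ¬ G.Adj x v) := by
  classical
  induction m using Nat.strong_induction_on with
  | _ m ih =>
  intro S hS
  have key : ∀ x ∈ S, (∃ y ∈ S, y ≠ x ∧ ¬ G.Adj x y) →
      ∃ v, Simp G S v ∧ v ≠ x ∧ ¬ G.Adj x v := by
    rintro x hx ⟨y0, hy0, hy0x, hy0a⟩
    let T : Set V := {y | y ∈ S ∧ y ≠ x ∧ ¬ G.Adj x y}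
    let R : V → V → Prop := fun u v => G.Adj u v ∧ u ∈ T ∧ v ∈ T
    have hRsym : Std.Symm R := ⟨fun u v h => ⟨h.1.symm, h.2.2, h.2.1⟩⟩
    let B := S.filter (fun y => y ∈ T ∧ Relation.ReflTransGen R y0 y)
    let K := S.filter (fun y => y ∉ B ∧ ∃ z ∈ B, G.Adj z y)
    have hB : ∀ y, y ∈ B ↔ y ∈ S ∧ y ∈ T ∧ Relation.ReflTransGen R y0 y := by simp [B]
    have hK : ∀ y, y ∈ K ↔ y ∈ S ∧ y ∉ B ∧ ∃ z ∈ B, G.Adj z y := by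
      intro y; simp only [K, Finset.mem_filter]
    clear_value B K
    have hy0T : y0 ∈ T := ⟨hy0, hy0x, hy0a⟩
    have hy0B : y0 ∈ B := (hB _).2 ⟨hy0, hy0T, .refl⟩
    have hxB : x ∉ B := fun h => ((hB _).1 h).2.1.2.1 rfl
    have hKx : ∀ y ∈ K, G.Adj x y := by
      intro y hy
      obtain ⟨hyS, hyB, z, hz, hzy⟩ := (hK _).1 hy
      obtain ⟨_, hzT, hzR⟩ := (hB _).1 hz
      by_contra hc
      by_cases hyx : y = x
      · subst hyx; exact hzT.2.2 hzy.symm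
      · have hyT : y ∈ T := ⟨hyS, hyx, hc⟩
        exact hyB ((hB _).2 ⟨hyS, hyT, hzR.tail ⟨hzy, hzT, hyT⟩⟩)
    have hKcl : ∀ a ∈ K, ∀ b ∈ K, a ≠ b → G.Adj a b := by
      intro a ha b hb hab
      obtain ⟨_, _, y, hy, hya⟩ := (hK _).1 ha
      obtain ⟨_, _, z, hz, hzb⟩ := (hK _).1 hb
      obtain ⟨_, hyT, hyR⟩ := (hB _).1 hy
      obtain ⟨_, hzT, hzR⟩ := (hB _).1 hz
      refine chordal_adj G hG T hab (hKx a ha) (hKx b hb) (fun y hy => hy.2) ?_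
      exact ipath_extend G T hya.symm hzb hyT hzT (ipath_of_reach G T
        ((Relation.ReflTransGen.stdSymm.symm _ _ hyR).trans hzR))
    have hnb : ∀ v ∈ B, ∀ a ∈ S, G.Adj v a → a ∈ B ∪ K := by
      intro v hv a ha hva
      by_cases haB : a ∈ B
      · exact Finset.mem_union_left _ haB
      · exact Finset.mem_union_right _ ((hK _).2 ⟨ha, haB, v, hv, hva⟩)
    have hxK : x ∉ K := fun h => (hKx x h).ne rfl
    have hBKS : B ∪ K ⊆ S := by
      intro y hy
      rcases Finset.mem_union.1 hy with h | h
      · exact ((hB _).1 h).1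
      · exact ((hK _).1 h).1
    have hlt : (B ∪ K).card < m := by
      rw [← hS]
      exact Finset.card_lt_card ⟨hBKS, fun h => by
        rcases Finset.mem_union.1 (h hx) with h | h
        · exact hxB h
        · exact hxK h⟩
    suffices ∃ v ∈ B, Simp G (B ∪ K) v by
      obtain ⟨v, hvB, hv⟩ := this
      obtain ⟨hvS, hvT, _⟩ := (hB _).1 hvB
      exact ⟨v, ⟨hvS, fun a ha b hb hva hvb hab =>
        hv.2 a (hnb v hvB a ha hva) b (hnb v hvB b hb hvb) hva hvb hab⟩, hvT.2⟩
    by_cases hun : ∃ y ∈ K, ∃ z ∈ B ∪ K, z ≠ y ∧ ¬ G.Adj y z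
    · obtain ⟨y, hy, hz⟩ := hun
      obtain ⟨v, hv, hvy, hva⟩ := (ih _ hlt _ rfl).2 y (Finset.mem_union_right _ hy) hz
      refine ⟨v, ?_, hv⟩
      rcases Finset.mem_union.1 hv.1 with h | h
      · exact h
      · exact absurd (hKcl y hy v h hvy.symm) hva
    · push Not at hun
      obtain ⟨v, hv⟩ := (ih _ (lt_of_le_of_lt (Finset.card_le_card Finset.subset_union_left) hlt)
        B rfl).1 ⟨y0, hy0B⟩
      refine ⟨v, hv.1, Finset.mem_union_left _ hv.1, ?_⟩
      intro a ha b hb hva hvb hab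
      by_cases haK : a ∈ K
      · exact hun a haK b hb hab.symm
      · by_cases hbK : b ∈ K
        · exact (hun b hbK a ha hab).symm
        · exact hv.2 a ((Finset.mem_union.1 ha).resolve_right haK) b
            ((Finset.mem_union.1 hb).resolve_right hbK) hva hvb hab
  refine ⟨?_, key⟩
  rintro ⟨x, hx⟩
  by_cases hux : ∃ y ∈ S, y ≠ x ∧ ¬ G.Adj x y
  · obtain ⟨v, hv, _⟩ := key x hx hux
    exact ⟨v, hv⟩
  · push Not at hux
    by_cases hne : (S.erase x).Nonempty
    · obtain ⟨v, hv⟩ := (ih _ (by rw [← hS]; exact Finset.card_erase_lt_of_mem hx) _ rfl).1 hne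
      refine ⟨v, Finset.mem_of_mem_erase hv.1, ?_⟩
      intro a ha b hb hva hvb hab
      by_cases hax : a = x
      · subst hax; exact hux b hb hab.symm
      · by_cases hbx : b = x
        · subst hbx; exact (hux a ha hab).symm
        · exact hv.2 a (Finset.mem_erase.2 ⟨hax, ha⟩) b (Finset.mem_erase.2 ⟨hbx, hb⟩) hva hvb hab
    · refine ⟨x, hx, ?_⟩
      intro a ha b hb hva hvb hab
      exact absurd ⟨a, Finset.mem_erase.2 ⟨hva.ne', ha⟩⟩ hne

theorem psd_sub {r : ℕ} {X : Matrix (Fin r) (Fin r) ℝ} (hX : X.PosSemidef) (v : Fin r) (s : ℝ) :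
    (X - (2 * s - s ^ 2 * X v v) • vecMulVec (fun i => X i v) (fun i => X i v)).PosSemidef := by
  have hsym : ∀ i j, X i j = X j i := fun i j => by simpa using hX.1.apply j i
  have h := hX.conjTranspose_mul_mul_same
    (1 - s • vecMulVec (Pi.single v (1 : ℝ)) (fun i => X i v))
  convert h using 1
  have e1 : X *ᵥ Pi.single v (1 : ℝ) = fun i => X i v := by
    ext i; simp
  have e2 : Pi.single v (1 : ℝ) ᵥ* X = fun i => X i v := by
    ext i; simp [hsym v i]
  have e3 : Matrix.conjTranspose (1 - s • vecMulVec (Pi.single v (1 : ℝ)) (fun i => X i v))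
      = 1 - s • vecMulVec (fun i => X i v) (Pi.single v (1 : ℝ)) := by
    ext i j
    simp [vecMulVec_apply, Matrix.one_apply, eq_comm, mul_comm]
  rw [e3, sub_mul, mul_sub, sub_mul]
  simp only [Matrix.one_mul, Matrix.mul_one, Matrix.smul_mul, Matrix.mul_smul, mul_vecMulVec,
    vecMulVec_mul, e1, e2, vecMulVec_mul_vecMulVec]
  ext i j
  simp [vecMulVec_apply]
  ring

theorem psd_zero {r : ℕ} {X : Matrix (Fin r) (Fin r) ℝ} (hX : X.PosSemidef) (v : Fin r)
    (h0 : X v v = 0) (i : Fin r) : X i v = 0 := by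
  by_contra hc
  have hp : 0 < X i v * X i v := mul_self_pos.2 hc
  have h := (psd_sub hX v ((X i i + 1) / (2 * (X i v * X i v)))).diag_nonneg (i := i)
  simp only [Matrix.sub_apply, Matrix.smul_apply, vecMulVec_apply, h0, smul_eq_mul, mul_zero,
    sub_zero] at h
  have e : 2 * ((X i i + 1) / (2 * (X i v * X i v))) * (X i v * X i v) = X i i + 1 := by
    field_simp
  linarith

theorem psd_decomp {r : ℕ} (G : SimpleGraph (Fin r)) (hG : IsChordalGraph G)
    (P : Matrix (Fin r) (Fin r) ℝ → Prop) (P0 : P 0) (Padd : ∀ A B, P A → P B → P (A + B))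
    (Pcl : ∀ (s : Finset (Fin r)) (A : Matrix (Fin r) (Fin r) ℝ), G.IsClique (s : Set (Fin r)) →
      A.PosSemidef → (∀ i j, ¬ (i ∈ s ∧ j ∈ s) → A i j = 0) → P A) (m : ℕ) :
    ∀ (S : Finset (Fin r)), S.card = m → ∀ X : Matrix (Fin r) (Fin r) ℝ, X.PosSemidef →
      (∀ i j, ¬ (G.Adj i j ∨ i = j) → X i j = 0) → (∀ i j, i ∉ S → X i j = 0) → P X := by
  classical
  induction m with
  | zero =>
    intro S hS X _ _ hXS
    obtain rfl := Finset.card_eq_zero.1 hS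
    have : X = 0 := by ext i j; exact hXS i j (by simp)
    rwa [this]
  | succ m ih =>
    intro S hS X hX hsp hXS
    have hsym : ∀ i j, X i j = X j i := fun i j => by simpa using hX.1.apply j i
    obtain ⟨v, hvS, hv⟩ := (simp_aux G hG _ S rfl).1 (Finset.card_pos.1 (by omega))
    have hcard : (S.erase v).card = m := by rw [Finset.card_erase_of_mem hvS]; omega
    by_cases h0 : X v v = 0
    · refine ih _ hcard X hX hsp ?_
      intro i j hi
      by_cases hiv : i = v
      · subst hiv; rw [hsym]; exact psd_zero hX _ h0 j
      · exact hXS i j (fun h => hi (Finset.mem_erase.2 ⟨hiv, h⟩))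
    · let c : Fin r → ℝ := fun i => X i v
      let s := S.filter (fun i => i = v ∨ G.Adj v i)
      have hc : ∀ i, i ∉ s → c i = 0 := by
        intro i hi
        by_cases hiS : i ∈ S
        · refine hsp i v ?_
          rintro (h | h)
          · exact hi (Finset.mem_filter.2 ⟨hiS, Or.inr h.symm⟩)
          · exact hi (Finset.mem_filter.2 ⟨hiS, Or.inl h⟩)
        · exact hXS i v hiS
      have hs : G.IsClique (s : Set (Fin r)) := by
        intro a ha b hb hab
        obtain ⟨haS, ha⟩ := Finset.mem_filter.1 ha
        obtain ⟨hbS, hb⟩ := Finset.mem_filter.1 hb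
        rcases ha with rfl | ha
        · rcases hb with rfl | hb
          · exact absurd rfl hab
          · exact hb
        · rcases hb with rfl | hb
          · exact ha.symm
          · exact hv a haS b hbS ha hb hab
      have hpos : 0 ≤ (X v v)⁻¹ := inv_nonneg.2 hX.diag_nonneg
      have hY := psd_sub hX v (X v v)⁻¹
      rw [show 2 * (X v v)⁻¹ - (X v v)⁻¹ ^ 2 * X v v = (X v v)⁻¹ by field_simp; norm_num] at hY
      have hA : ((X v v)⁻¹ • vecMulVec c c).PosSemidef := by
        refine Matrix.PosSemidef.smul ?_ hpos
        simpa using posSemidef_vecMulVec_self_star c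
      have hA0 : ∀ i j, ¬ (i ∈ s ∧ j ∈ s) → ((X v v)⁻¹ • vecMulVec c c) i j = 0 := by
        intro i j hij
        simp only [Matrix.smul_apply, vecMulVec_apply, smul_eq_mul]
        by_cases hi : i ∈ s
        · rw [hc j (fun h => hij ⟨hi, h⟩)]; simp
        · rw [hc i hi]; simp
      rw [← sub_add_cancel X ((X v v)⁻¹ • vecMulVec c c)]
      refine Padd _ _ (ih _ hcard _ hY ?_ ?_) (Pcl s _ hs hA hA0)
      · intro i j hij
        have := hA0 i j (fun h => hij (by
          by_cases e : i = j
          · exact Or.inr e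
          · exact Or.inl (hs h.1 h.2 e)))
        rw [Matrix.sub_apply, hsp i j hij, zero_sub, neg_eq_zero]
        exact this
      · intro i j hi
        by_cases hiv : i = v
        · subst hiv
          simp only [Matrix.sub_apply, Matrix.smul_apply, vecMulVec_apply, smul_eq_mul]
          have e1 : c i = X i i := rfl
          have e2 : c j = X i j := hsym j i
          rw [e1, e2, ← mul_assoc, inv_mul_cancel₀ h0, one_mul, sub_self]
        · have hiS : i ∉ S := fun h => hi (Finset.mem_erase.2 ⟨hiv, h⟩)
          have e1 : c i = 0 := hXS i v hiS
          simp only [Matrix.sub_apply, Matrix.smul_apply, vecMulVec_apply, smul_eq_mul]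
          rw [e1, hXS i j hiS]; simp

theorem index_mul {r : ℕ} (C : Finset (Fin r)) :
    (indexMatrix ℝ C)ᵀ * indexMatrix ℝ C = Matrix.diagonal (fun i => if i ∈ C then 1 else 0) := by
  classical
  ext a b
  simp only [Matrix.mul_apply, Matrix.transpose_apply, indexMatrix, Matrix.of_apply,
    Matrix.diagonal_apply]
  by_cases ha : a ∈ C
  · rw [Finset.sum_eq_single ((C.orderIsoOfFin rfl).symm ⟨a, ha⟩)]
    · simp [ha]
    · intro i _ hi
      have : ((C.orderIsoOfFin rfl i : Fin r)) ≠ a := by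
        rintro h
        apply hi
        rw [OrderIso.eq_symm_apply]
        exact Subtype.ext h
      simp only [this, if_false, zero_mul]
    · simp
  · rw [Finset.sum_eq_zero]
    · simp [ha]
    · intro i _
      have : ((C.orderIsoOfFin rfl i : Fin r)) ≠ a := by
        rintro h
        exact ha (h ▸ (C.orderIsoOfFin rfl i).2)
      simp only [this, if_false, zero_mul]

/-- **Chordal decomposition of sparse PSD matrices** (Agler et al., Griewank–Toint):
for a chordal graph `G` on `{1,…,r}` with maximal cliques `C_1,…,C_t`, a symmetric
matrix `X ∈ S^r(E,0)` is PSD iff `X = ∑ₖ E_{C_k}ᵀ X_k E_{C_k}` for some PSD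
matrices `X_k ∈ S^{|C_k|}_+`. -/
theorem psd_chordal_decomposition {r t : ℕ}
    (G : SimpleGraph (Fin r)) (hchordal : IsChordalGraph G)
    (C : Fin t → Finset (Fin r))
    (hmax : ∀ k, IsMaxClique G (C k))
    (hall : ∀ s : Finset (Fin r), IsMaxClique G s → ∃ k, C k = s)
    (X : Matrix (Fin r) (Fin r) ℝ)
    (hXsym : X.IsSymm)
    (hXsparse : ∀ i j, ¬ (G.Adj i j ∨ i = j) → X i j = 0) :
    X.PosSemidef ↔
      ∃ Xk : (k : Fin t) → Matrix (Fin (C k).card) (Fin (C k).card) ℝ,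
        (∀ k, (Xk k).PosSemidef) ∧
        X = ∑ k : Fin t, (indexMatrix ℝ (C k))ᵀ * Xk k * indexMatrix ℝ (C k) := by
  classical
  constructor
  · intro hX
    refine psd_decomp G hchordal (fun X => ∃ Xk : (k : Fin t) →
        Matrix (Fin (C k).card) (Fin (C k).card) ℝ, (∀ k, (Xk k).PosSemidef) ∧
        X = ∑ k : Fin t, (indexMatrix ℝ (C k))ᵀ * Xk k * indexMatrix ℝ (C k)) ?_ ?_ ?_ _
      Finset.univ rfl X hX hXsparse (by simp)
    · exact ⟨fun _ => 0, fun _ => Matrix.PosSemidef.zero, by simp⟩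
    · rintro A B ⟨Ak, hA, rfl⟩ ⟨Bk, hB, rfl⟩
      refine ⟨fun k => Ak k + Bk k, fun k => (hA k).add (hB k), ?_⟩
      simp [Matrix.mul_add, Matrix.add_mul, Finset.sum_add_distrib]
    · intro s A hs hA hA0
      obtain ⟨u, hsu, hu⟩ := (Set.toFinite {u : Finset (Fin r) | G.IsClique (u : Set (Fin r))}
        ).exists_le_maximal hs
      obtain ⟨k, hk⟩ := hall u ⟨hu.1, fun w hw huw => le_antisymm huw (hu.2 hw huw)⟩
      refine ⟨fun l => if l = k then indexMatrix ℝ (C l) * A * (indexMatrix ℝ (C l))ᵀ else 0,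
        ?_, ?_⟩
      · intro l
        dsimp only
        split_ifs
        · simpa using hA.mul_mul_conjTranspose_same (indexMatrix ℝ (C l))
        · exact Matrix.PosSemidef.zero
      · rw [Finset.sum_eq_single k (by intro l _ hl; simp [hl]) (by simp)]
        simp only [if_true]
        have : (indexMatrix ℝ (C k))ᵀ * (indexMatrix ℝ (C k) * A * (indexMatrix ℝ (C k))ᵀ) *
            indexMatrix ℝ (C k) = ((indexMatrix ℝ (C k))ᵀ * indexMatrix ℝ (C k)) * A *
              ((indexMatrix ℝ (C k))ᵀ * indexMatrix ℝ (C k)) := by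
          simp only [Matrix.mul_assoc]
        rw [this, index_mul, hk]
        ext i j
        rw [Matrix.mul_diagonal, Matrix.diagonal_mul]
        by_cases h : i ∈ s ∧ j ∈ s
        · simp [hsu h.1, hsu h.2]
        · rw [hA0 i j h]; simp
  · rintro ⟨Xk, hk, rfl⟩
    refine Matrix.posSemidef_sum _ (fun k _ => ?_)
    simpa using (hk k).conjTranspose_mul_mul_same (indexMatrix ℝ (C k))
end

section
/- Let G = (V, E) be a chordal graph on vertex set V = {1, ..., r} with maximal cliques C_1, ..., C_t. A matrix Z ∈ S^r(E, 0) has a positive semidefinite completion (i.e., Z ∈ S^r_+(E, ?), meaning there exists a positive semidefinite matrix F with F_ij = Z_ij for all (i,j) ∈ E*) if and only if E_{C_k} Z E_{C_k}^T ∈ S^{|C_k|}_+ for every k = 1, ..., t. -/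
open Matrix

/-! ### Gluing Gram representations -/

lemma exists_isometry_of_inner_eq {V E : Type*} [Fintype V] [NormedAddCommGroup E]
    [InnerProductSpace ℝ E] [FiniteDimensional ℝ E] (u w : V → E)
    (h : ∀ i j, inner ℝ (u i) (u j) = inner ℝ (w i) (w j)) :
    ∃ φ : E →ₗᵢ[ℝ] E, ∀ i, φ (u i) = w i := by
  classical
  let Tu := Fintype.linearCombination ℝ u
  let Tw := Fintype.linearCombination ℝ w
  have hnorm : ∀ c, ‖Tu c‖ = ‖Tw c‖ := by
    intro c
    have h2 : ‖Tu c‖ ^ 2 = ‖Tw c‖ ^ 2 := by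
      rw [← real_inner_self_eq_norm_sq, ← real_inner_self_eq_norm_sq]
      simp only [Tu, Tw, Fintype.linearCombination_apply, sum_inner, inner_sum, inner_smul_left,
        inner_smul_right, h]
    exact (pow_left_inj₀ (norm_nonneg _) (norm_nonneg _) two_ne_zero).1 h2
  obtain ⟨s, hs⟩ := Tu.rangeRestrict.exists_rightInverse_of_surjective
    (LinearMap.range_rangeRestrict Tu)
  have hs' : ∀ y : LinearMap.range Tu, Tu (s y) = y := by
    intro y
    have := LinearMap.congr_fun hs y
    exact congrArg Subtype.val this
  let g : LinearMap.range Tu →ₗᵢ[ℝ] E :=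
    { toLinearMap := Tw ∘ₗ s
      norm_map' := by
        intro y
        change ‖Tw (s y)‖ = ‖y‖
        rw [← hnorm, hs']
        rfl }
  refine ⟨g.extend, fun i => ?_⟩
  have hui : Tu (Pi.single i 1) = u i := by simp [Tu]
  have hwi : Tw (Pi.single i 1) = w i := by simp [Tw]
  have h1 := g.extend_apply ⟨u i, ⟨_, hui⟩⟩
  rw [h1]
  change Tw (s _) = w i
  rw [← hwi, ← sub_eq_zero, ← map_sub, ← norm_eq_zero, ← hnorm, norm_eq_zero, map_sub, hs', hui]
  simp

/-! ### Restricted graphs and induced paths -/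

/-- The graph `G` with only the edges inside `T`. -/
def restrictG {V : Type*} (G : SimpleGraph V) (T : Set V) : SimpleGraph V where
  Adj x y := G.Adj x y ∧ x ∈ T ∧ y ∈ T
  symm := ⟨fun _ _ h => ⟨h.1.symm, h.2.2, h.2.1⟩⟩
  loopless := ⟨fun x h => G.loopless.irrefl x h.1⟩

lemma restrictG_mono {V : Type*} (G : SimpleGraph V) {T T' : Set V} (h : T ⊆ T') :
    restrictG G T ≤ restrictG G T' := fun _ _ hh => ⟨hh.1, h hh.2.1, h hh.2.2⟩

/-- Invariance principle for reachability. -/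
lemma reachable_induct {V : Type*} {H : SimpleGraph V} {P : V → Prop} {a b : V}
    (h : H.Reachable a b) (ha : P a) (hstep : ∀ x y, P x → H.Adj x y → P y) : P b := by
  obtain ⟨p⟩ := h
  induction p with
  | nil => exact ha
  | cons hadj p ih => exact ih (hstep _ _ ha hadj)

/-- The component of `a` in `T`. -/
def compG {V : Type*} (G : SimpleGraph V) (T : Set V) (a : V) : Set V :=
  {x | (restrictG G T).Reachable a x}

lemma compG_step {V : Type*} {G : SimpleGraph V} {T : Set V} {a x y : V} (hx : x ∈ compG G T a)
    (hxT : x ∈ T) (hy : y ∈ T) (h : G.Adj x y) : y ∈ compG G T a :=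
  SimpleGraph.Reachable.trans hx (SimpleGraph.Adj.reachable ⟨h, hxT, hy⟩)

lemma compG_subset {V : Type*} {G : SimpleGraph V} {T : Set V} {a x : V} (ha : a ∈ T)
    (hx : x ∈ compG G T a) : x ∈ T :=
  reachable_induct (P := fun x => x ∈ T) hx ha fun _ _ _ h => h.2.2

lemma compG_reach {V : Type*} {G : SimpleGraph V} {T : Set V} {a x : V}
    (hx : x ∈ compG G T a) : (restrictG G (compG G T a)).Reachable a x := by
  have := reachable_induct (P := fun x => x ∈ compG G T a ∧
    (restrictG G (compG G T a)).Reachable a x) hx ⟨SimpleGraph.Reachable.refl _, .refl _⟩ ?_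
  · exact this.2
  · rintro x y ⟨h1, h2⟩ h
    have hy : y ∈ compG G T a := compG_step h1 h.2.1 h.2.2 h.1
    exact ⟨hy, h2.trans (SimpleGraph.Adj.reachable ⟨h.1, h1, hy⟩)⟩

/-- Existence of an induced path. -/
lemma exists_induced_path {V : Type*} {G : SimpleGraph V} {T : Set V} {c d : V}
    (hne : c ≠ d) (hnadj : ¬ G.Adj c d) (hr : (restrictG G T).Reachable c d) :
    ∃ (m : ℕ) (p : ℕ → V), 2 ≤ m ∧ p 0 = c ∧ p m = d ∧ (∀ i ≤ m, p i ∈ T) ∧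
      (∀ i < m, G.Adj (p i) (p (i + 1))) ∧
      (∀ i j, i ≤ m → j ≤ m → p i = p j → i = j) ∧
      (∀ i j, i < j → j ≤ m → G.Adj (p i) (p j) → j = i + 1) := by
  obtain ⟨w, hw⟩ := hr.exists_walk_length_eq_dist
  have hpos : 2 ≤ w.length := by
    rw [hw]
    exact hr.one_lt_dist_of_ne_of_not_adj hne fun h => hnadj h.1
  have hadj : ∀ i < w.length, (restrictG G T).Adj (w.getVert i) (w.getVert (i + 1)) :=
    fun i hi => w.adj_getVert_succ hi
  have hdist : ∀ i ≤ w.length, (restrictG G T).dist c (w.getVert i) = i := by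
    intro i hi
    have h1 := SimpleGraph.dist_le (w.take i)
    have h2 := SimpleGraph.dist_le (w.drop i)
    rw [SimpleGraph.Walk.take_length] at h1
    rw [SimpleGraph.Walk.drop_length] at h2
    have h3 := SimpleGraph.Reachable.dist_triangle_left (w.take i).reachable d
    omega
  have hT : ∀ i ≤ w.length, w.getVert i ∈ T := by
    intro i hi
    rcases Nat.lt_or_ge i w.length with h | h
    · exact (hadj i h).2.1
    · have := (hadj (i - 1) (by omega)).2.2
      rwa [show i - 1 + 1 = i by omega] at this
  refine ⟨w.length, w.getVert, hpos, by simp, by simp, hT, fun i hi => (hadj i hi).1, ?_, ?_⟩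
  · intro i j hi hj h
    rw [← hdist i hi, ← hdist j hj, h]
  · intro i j hij hj h
    have ha : (restrictG G T).Adj (w.getVert i) (w.getVert j) := ⟨h, hT i (by omega), hT j hj⟩
    have h1 := hdist i (by omega)
    have h2 := hdist j hj
    have h3 := SimpleGraph.Reachable.dist_triangle_left (w.take i).reachable (w.getVert j)
    rw [SimpleGraph.dist_eq_one_iff_adj.2 ha] at h3
    omega

/-- Chordality with cycles indexed by natural numbers. -/
lemma chordal_nat {V : Type*} {G : SimpleGraph V} (hG : IsChordalGraph G) (k : ℕ) (hk : 4 ≤ k)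
    (v : ℕ → V) (hinj : ∀ i j, i < j → j < k → v i ≠ v j)
    (hadj : ∀ i, i + 1 < k → G.Adj (v i) (v (i + 1))) (hlast : G.Adj (v (k - 1)) (v 0)) :
    ∃ i j, i < j ∧ j < k ∧ j ≠ i + 1 ∧ ¬ (i = 0 ∧ j = k - 1) ∧ G.Adj (v i) (v j) := by
  have : NeZero k := ⟨by omega⟩
  have : Fact (1 < k) := ⟨by omega⟩
  have hsucc : ∀ i : ZMod k, (i + 1).val = (i.val + 1) % k := by
    intro i
    rw [ZMod.val_add, ZMod.val_one]
  have hlt : ∀ i : ZMod k, i.val < k := fun i => ZMod.val_lt i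
  have hmain := hG k hk (fun i => v i.val) ?_ ?_
  · obtain ⟨i, j, h1, h2, h3, h4⟩ := hmain
    have key : ∀ i j : ZMod k, j ≠ i + 1 → i ≠ j + 1 → G.Adj (v i.val) (v j.val) →
        i.val < j.val →
        ∃ i j, i < j ∧ j < k ∧ j ≠ i + 1 ∧ ¬ (i = 0 ∧ j = k - 1) ∧ G.Adj (v i) (v j) := by
      intro i j h2 h3 h4 hij
      refine ⟨i.val, j.val, hij, hlt j, ?_, ?_, h4⟩
      · intro h
        apply h2
        apply ZMod.val_injective
        rw [hsucc, h, Nat.mod_eq_of_lt]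
        rw [← h]
        exact hlt j
      · rintro ⟨ha, hb⟩
        apply h3
        apply ZMod.val_injective
        rw [hsucc, ha, hb, show k - 1 + 1 = k by omega, Nat.mod_self]
    rcases lt_trichotomy i.val j.val with h | h | h
    · exact key i j h2 h3 h4 h
    · exact absurd (ZMod.val_injective _ h) h1
    · exact key j i h3 h2 h4.symm h
  · intro i j h
    apply ZMod.val_injective
    rcases lt_trichotomy i.val j.val with h' | h' | h'
    · exact absurd h (hinj _ _ h' (hlt j))
    · exact h'
    · exact absurd h.symm (hinj _ _ h' (hlt i))
  · intro i
    change G.Adj (v i.val) (v (i + 1).val)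
    rw [hsucc]
    by_cases h : i.val + 1 = k
    · rw [h, Nat.mod_self, show i.val = k - 1 by omega]
      exact hlast
    · have := hlt i
      rw [Nat.mod_eq_of_lt (by omega)]
      exact hadj _ (by omega)

/-- Two vertices joined through two sides with no edges in between are adjacent. -/
lemma adj_of_two_sides {V : Type*} {G : SimpleGraph V} (hG : IsChordalGraph G) {A B : Set V}
    (hAB : ∀ x ∈ A, ∀ y ∈ B, x ≠ y ∧ ¬ G.Adj x y) {c d : V} (hne : c ≠ d)
    (hcA : c ∉ A) (hdA : d ∉ A) (hcB : c ∉ B) (hdB : d ∉ B)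
    (hrA : (restrictG G (A ∪ {c, d})).Reachable c d)
    (hrB : (restrictG G (B ∪ {c, d})).Reachable d c) : G.Adj c d := by
  by_contra hnadj
  obtain ⟨m, p, hm, hp0, hpm, hpT, hpadj, hpinj, hpind⟩ := exists_induced_path hne hnadj hrA
  obtain ⟨l, q, hl, hq0, hql, hqT, hqadj, hqinj, hqind⟩ :=
    exists_induced_path hne.symm (fun h => hnadj h.symm) hrB
  have hpA : ∀ i, 0 < i → i < m → p i ∈ A := by
    intro i h0 h1
    rcases hpT i h1.le with h | h | h
    · exact h
    · have := hpinj i 0 h1.le (by omega) (by rw [hp0]; exact h)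
      omega
    · have := hpinj i m h1.le le_rfl (by rw [hpm]; exact h)
      omega
  have hqB : ∀ i, 0 < i → i < l → q i ∈ B := by
    intro i h0 h1
    rcases hqT i h1.le with h | h | h
    · exact h
    · have := hqinj i l h1.le le_rfl (by rw [hql]; exact h)
      omega
    · have := hqinj i 0 h1.le (by omega) (by rw [hq0]; exact h)
      omega
  let v : ℕ → V := fun n => if n ≤ m then p n else q (n - m)
  have hv1 : ∀ n, n ≤ m → v n = p n := fun n hn => if_pos hn
  have hv2 : ∀ n, m < n → v n = q (n - m) := fun n hn => if_neg (by omega)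
  have hv2' : ∀ n, m ≤ n → v n = q (n - m) := by
    intro n hn
    rcases hn.eq_or_lt with h | h
    · subst h
      rw [hv1 _ le_rfl, hpm, Nat.sub_self, hq0]
    · exact hv2 n h
  have hv0 : v 0 = q l := by rw [hv1 0 (by omega), hp0, hql]
  have hmain := chordal_nat hG (m + l) (by omega) v ?_ ?_ ?_
  · obtain ⟨i, j, hij, hj, hj1, hj2, hadj⟩ := hmain
    by_cases hjm : j ≤ m
    · rw [hv1 i (by omega), hv1 j hjm] at hadj
      exact hj1 (hpind i j hij hjm hadj)
    · by_cases him : m ≤ i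
      · rw [hv2' i him, hv2' j (by omega)] at hadj
        have := hqind _ _ (by omega) (by omega) hadj
        omega
      · by_cases hi0 : i = 0
        · subst hi0
          rw [hv0, hv2' j (by omega)] at hadj
          have := hqind _ _ (by omega) le_rfl hadj.symm
          omega
        · rw [hv1 i (by omega), hv2' j (by omega)] at hadj
          exact (hAB _ (hpA i (by omega) (by omega)) _ (hqB _ (by omega) (by omega))).2 hadj
  · intro i j hij hj h
    by_cases hjm : j ≤ m
    · rw [hv1 i (by omega), hv1 j hjm] at h
      have := hpinj _ _ (by omega) (by omega) h
      omega
    · by_cases him : m ≤ i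
      · rw [hv2' i him, hv2' j (by omega)] at h
        have := hqinj _ _ (by omega) (by omega) h
        omega
      · by_cases hi0 : i = 0
        · subst hi0
          rw [hv0, hv2' j (by omega)] at h
          have := hqinj _ _ (by omega) (by omega) h
          omega
        · rw [hv1 i (by omega), hv2' j (by omega)] at h
          exact (hAB _ (hpA i (by omega) (by omega)) _ (hqB _ (by omega) (by omega))).1 h
  · intro i hi
    by_cases him : m ≤ i
    · rw [hv2' i him, hv2' (i + 1) (by omega), show i + 1 - m = i - m + 1 by omega]
      exact hqadj _ (by omega)
    · rw [hv1 i (by omega), hv1 (i + 1) (by omega)]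
      exact hpadj _ (by omega)
  · rw [hv0, hv2' _ (by omega)]
    have := hqadj (l - 1) (by omega)
    rwa [show l - 1 + 1 = l by omega, show l - 1 = m + l - 1 - m by omega] at this

lemma reach_via {V : Type*} {G : SimpleGraph V} {T : Set V} {a c d x y : V}
    (hx : x ∈ compG G T a) (hy : y ∈ compG G T a) (hcx : G.Adj c x) (hdy : G.Adj d y) :
    (restrictG G (compG G T a ∪ {c, d})).Reachable c d := by
  have hmono := restrictG_mono G (Set.subset_union_left (s := compG G T a) (t := {c, d}))
  have h1 := (compG_reach hx).mono hmono
  have h2 := (compG_reach hy).mono hmono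
  have h3 : (restrictG G (compG G T a ∪ {c, d})).Adj c x := ⟨hcx, by simp, Or.inl hx⟩
  have h4 : (restrictG G (compG G T a ∪ {c, d})).Adj y d := ⟨hdy.symm, Or.inl hy, by simp⟩
  exact h3.reachable.trans (h1.symm.trans (h2.trans h4.reachable))

/-- If `c` is essential in the separator then it has a neighbour in the component. -/
lemma essential_nbr {V : Type*} {G : SimpleGraph V} {T : Set V} {a b c : V} (ha : a ∈ T)
    (hb : b ∉ compG G T a) (h : (restrictG G (insert c T)).Reachable a b) :
    ∃ x ∈ compG G T a, G.Adj c x := by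
  by_contra hcon
  push Not at hcon
  apply hb
  refine reachable_induct (P := fun x => x ∈ compG G T a) h (SimpleGraph.Reachable.refl _) ?_
  intro x y hx hxy
  have hxT := compG_subset ha hx
  rcases hxy.2.2 with hy | hy
  · subst hy
    exact absurd hxy.1.symm (hcon x hx)
  · exact compG_step hx hxT hy hxy.1

/-- Clique separators in chordal graphs. -/
lemma exists_clique_separator {V : Type*} [DecidableEq V] {G : SimpleGraph V}
    (hG : IsChordalGraph G) (S : Finset V) {a b : V} (ha : a ∈ S) (hb : b ∈ S) (hab : a ≠ b)
    (hn : ¬ G.Adj a b) :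
    ∃ C ⊆ S, G.IsClique (C : Set V) ∧ a ∉ C ∧ b ∉ C ∧ b ∉ compG G ((S : Set V) \ C) a := by
  classical
  let P : Finset V → Prop := fun C => C ⊆ S ∧ a ∉ C ∧ b ∉ C ∧ b ∉ compG G ((S : Set V) \ C) a
  have hex : ∃ C, P C := by
    refine ⟨(S.erase a).erase b, ?_, by simp, by simp, ?_⟩
    · exact (Finset.erase_subset _ _).trans (Finset.erase_subset _ _)
    · intro h
      have := reachable_induct (P := fun x => x = a) h rfl ?_
      · exact hab this.symm
      · rintro x y rfl ⟨h1, h2, h3⟩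
        have : y = x ∨ y = b := by
          simp at h3
          tauto
        rcases this with h | h
        · exact h
        · subst h
          exact absurd h1 hn
  obtain ⟨C, hC⟩ : ∃ C, Minimal P C := exists_minimal_of_wellFoundedLT P hex
  obtain ⟨hCS, haC, hbC, hsep⟩ := hC.prop
  refine ⟨C, hCS, ?_, haC, hbC, hsep⟩
  set T : Set V := (S : Set V) \ C with hT
  have haT : a ∈ T := ⟨ha, haC⟩
  have hbT : b ∈ T := ⟨hb, hbC⟩
  have hess : ∀ c ∈ C, (restrictG G (insert c T)).Reachable a b := by
    intro c hc
    by_contra hcon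
    have hP : P (C.erase c) := by
      refine ⟨(Finset.erase_subset _ _).trans hCS, fun h => haC (Finset.mem_of_mem_erase h),
        fun h => hbC (Finset.mem_of_mem_erase h), fun h => hcon ?_⟩
      refine SimpleGraph.Reachable.mono (restrictG_mono G ?_) h
      intro x hx
      by_cases hxc : x = c
      · exact Or.inl hxc
      · refine Or.inr ⟨hx.1, fun h => hx.2 ?_⟩
        simpa [hxc] using h
    have := hC.le_of_le hP (Finset.erase_subset _ _)
    exact Finset.notMem_erase c C (this hc)
  have hsep' : a ∉ compG G T b := fun h => hsep (SimpleGraph.Reachable.symm h)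
  intro c hc d hd hne
  have hCT : ∀ x ∈ C, ∀ z ∈ T, x ∉ compG G T z := fun x hx z hz h => (compG_subset hz h).2 hx
  obtain ⟨x, hx, hcx⟩ := essential_nbr haT hsep (hess c hc)
  obtain ⟨y, hy, hdy⟩ := essential_nbr haT hsep (hess d hd)
  obtain ⟨x', hx', hcx'⟩ := essential_nbr hbT hsep' (hess c hc).symm
  obtain ⟨y', hy', hdy'⟩ := essential_nbr hbT hsep' (hess d hd).symm
  refine adj_of_two_sides hG (A := compG G T a) (B := compG G T b) ?_ hne (hCT c hc a haT)
    (hCT d hd a haT) (hCT c hc b hbT) (hCT d hd b hbT) (reach_via hx hy hcx hdy) ?_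
  · intro x hx y hy
    have hyx : y ∉ compG G T a := fun h =>
      hsep (SimpleGraph.Reachable.trans h (SimpleGraph.Reachable.symm hy))
    refine ⟨fun h => hyx (h ▸ hx), fun h => hyx ?_⟩
    exact compG_step hx (compG_subset haT hx) (compG_subset hbT hy) h
  · have := reach_via hy' hx' hdy' hcx'
    rwa [Set.pair_comm] at this

/-! ### Gram completions -/

lemma gram_completion {V E : Type*} [Fintype V] [DecidableEq V] [NormedAddCommGroup E]
    [InnerProductSpace ℝ E] [FiniteDimensional ℝ E] {G : SimpleGraph V} (hG : IsChordalGraph G)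
    (Z : V → V → ℝ)
    (hcl : ∀ Q : Finset V, G.IsClique (Q : Set V) →
      ∃ x : V → E, ∀ i ∈ Q, ∀ j ∈ Q, inner ℝ (x i) (x j) = Z i j) (S : Finset V) :
    ∃ x : V → E, ∀ i ∈ S, ∀ j ∈ S, (G.Adj i j ∨ i = j) → inner ℝ (x i) (x j) = Z i j := by
  classical
  induction S using Finset.strongInduction with
  | H S ih =>
    by_cases hS : G.IsClique (S : Set V)
    · obtain ⟨x, hx⟩ := hcl S hS
      exact ⟨x, fun i hi j hj _ => hx i hi j hj⟩
    · have : ∃ a ∈ S, ∃ b ∈ S, a ≠ b ∧ ¬ G.Adj a b := by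
        by_contra hcon
        push Not at hcon
        exact hS fun a ha b hb hab => hcon a ha b hb hab
      obtain ⟨a, ha, b, hb, hab, hn⟩ := this
      obtain ⟨C, hCS, hC, haC, hbC, hsep⟩ := exists_clique_separator hG S ha hb hab hn
      set A : Set V := compG G ((S : Set V) \ C) a with hA
      have haA : a ∈ A := SimpleGraph.Reachable.refl _
      have haT : a ∈ (S : Set V) \ C := ⟨ha, haC⟩
      have hAT : ∀ x ∈ A, x ∈ (S : Set V) \ C := fun x hx => compG_subset haT hx
      obtain ⟨x, hx⟩ := ih (S.filter fun i => i ∈ A ∨ i ∈ C) (by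
        refine Finset.filter_ssubset.2 ⟨b, hb, ?_⟩
        tauto)
      obtain ⟨y, hy⟩ := ih (S.filter fun i => i ∉ A) (by
        refine Finset.filter_ssubset.2 ⟨a, ha, ?_⟩
        tauto)
      have hCA : ∀ i ∈ C, i ∉ A := fun i hi h => (hAT i h).2 hi
      have hCadj : ∀ i ∈ C, ∀ j ∈ C, G.Adj i j ∨ i = j := by
        intro i hi j hj
        by_cases h : i = j
        · exact Or.inr h
        · exact Or.inl (hC hi hj h)
      obtain ⟨φ, hφ⟩ := exists_isometry_of_inner_eq (fun i : C => x i) (fun i : C => y i) (by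
        rintro ⟨i, hi⟩ ⟨j, hj⟩
        change inner ℝ (x i) (x j) = inner ℝ (y i) (y j)
        rw [hx i (by simp [hi, hCS hi]) j (by simp [hj, hCS hj]) (hCadj i hi j hj),
          hy i (by simp [hCA i hi, hCS hi]) j (by simp [hCA j hj, hCS hj]) (hCadj i hi j hj)])
      have hφ' : ∀ i ∈ C, φ (x i) = y i := fun i hi => hφ ⟨i, hi⟩
      let z : V → E := fun i => if i ∈ A then φ (x i) else y i
      have hz1 : ∀ i, i ∈ A ∨ i ∈ C → z i = φ (x i) := by
        intro i hi
        by_cases h : i ∈ A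
        · exact if_pos h
        · rw [hφ' i (by tauto)]
          exact if_neg h
      have hz2 : ∀ i, i ∉ A → z i = y i := fun i hi => if_neg hi
      have hnb : ∀ i ∈ A, ∀ j ∈ S, G.Adj i j → j ∈ A ∨ j ∈ C := by
        intro i hi j hj h
        by_cases hjC : j ∈ C
        · exact Or.inr hjC
        · exact Or.inl (compG_step hi (hAT i hi) ⟨hj, hjC⟩ h)
      have hboth : ∀ i ∈ S, ∀ j ∈ S, (G.Adj i j ∨ i = j) → i ∈ A ∨ i ∈ C → j ∈ A ∨ j ∈ C →
          inner ℝ (z i) (z j) = Z i j := by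
        intro i hi j hj hij h1 h2
        rw [hz1 i h1, hz1 j h2, LinearIsometry.inner_map_map]
        exact hx i (by simp [hi, h1]) j (by simp [hj, h2]) hij
      refine ⟨z, fun i hi j hj hij => ?_⟩
      by_cases hiA : i ∈ A
      · refine hboth i hi j hj hij (Or.inl hiA) ?_
        rcases hij with h | h
        · exact hnb i hiA j hj h
        · exact Or.inl (h ▸ hiA)
      · by_cases hjA : j ∈ A
        · refine hboth i hi j hj hij ?_ (Or.inl hjA)
          rcases hij with h | h
          · exact hnb j hjA i hi h.symm
          · exact Or.inl (h ▸ hjA)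
        · rw [hz2 i hiA, hz2 j hjA]
          exact hy i (by simp [hi, hiA]) j (by simp [hj, hjA]) hij

lemma indexMatrix_conj {r : ℕ} (C : Finset (Fin r)) (Z : Matrix (Fin r) (Fin r) ℝ) :
    indexMatrix ℝ C * Z * (indexMatrix ℝ C)ᵀ =
      Z.submatrix (fun i => (C.orderIsoOfFin rfl i : Fin r))
        (fun i => (C.orderIsoOfFin rfl i : Fin r)) := by
  ext i j
  simp only [Matrix.mul_apply, indexMatrix, Matrix.transpose_apply, Matrix.of_apply,
    Matrix.submatrix_apply, ite_mul, mul_ite, one_mul, mul_one, zero_mul, mul_zero,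
    Finset.sum_ite_eq, Finset.mem_univ, if_true]

lemma indexMatrix_lift {r : ℕ} (C : Finset (Fin r)) (M : Matrix (Fin C.card) (Fin C.card) ℝ)
    (a b : Fin C.card) :
    ((indexMatrix ℝ C)ᵀ * M * (indexMatrix ℝ C)) (C.orderIsoOfFin rfl a : Fin r)
      (C.orderIsoOfFin rfl b : Fin r) = M a b := by
  have hinj : ∀ i j : Fin C.card, ((C.orderIsoOfFin rfl i : Fin r) = C.orderIsoOfFin rfl j) ↔
      i = j := by
    intro i j
    rw [← Subtype.ext_iff]
    simp
  simp only [Matrix.mul_apply, indexMatrix, Matrix.transpose_apply, Matrix.of_apply, hinj]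
  simp

open scoped MatrixOrder Matrix.Norms.L2Operator in
/-- Gram vectors for a positive semidefinite matrix. -/
lemma exists_gram {r : ℕ} (M : Matrix (Fin r) (Fin r) ℝ) (hM : M.PosSemidef) :
    ∃ x : Fin r → EuclideanSpace ℝ (Fin r), ∀ i j, inner ℝ (x i) (x j) = M i j := by
  obtain ⟨B, hB⟩ := CStarAlgebra.nonneg_iff_eq_star_mul_self.mp hM.nonneg
  refine ⟨fun i => WithLp.toLp 2 fun k => B k i, fun i j => ?_⟩
  rw [hB]
  simp [Matrix.star_eq_conjTranspose, Matrix.mul_apply, PiLp.inner_apply, mul_comm]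

lemma exists_maxClique {r : ℕ} (G : SimpleGraph (Fin r)) (Q : Finset (Fin r))
    (hQ : G.IsClique (Q : Set (Fin r))) : ∃ s, Q ⊆ s ∧ IsMaxClique G s := by
  obtain ⟨s, hs, hmax⟩ := Set.Finite.exists_le_maximal
    (Set.toFinite {t : Finset (Fin r) | G.IsClique (t : Set (Fin r))}) hQ
  exact ⟨s, hs, hmax.prop, fun t ht hst => le_antisymm hst (hmax.le_of_ge ht hst)⟩

/-- **Chordal PSD completion** (Grone et al.): for a chordal graph `G` on `{1,…,r}`
with maximal cliques `C_1,…,C_t`, a matrix `Z ∈ S^r(E,0)` has a PSD completion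
(a PSD matrix `F` agreeing with `Z` on `E* = E ∪ {(i,i)}`) iff every principal
submatrix `E_{C_k} Z E_{C_k}ᵀ` is PSD. -/
theorem psd_chordal_completion {r t : ℕ}
    (G : SimpleGraph (Fin r)) (hchordal : IsChordalGraph G)
    (C : Fin t → Finset (Fin r))
    (hmax : ∀ k, IsMaxClique G (C k))
    (hall : ∀ s : Finset (Fin r), IsMaxClique G s → ∃ k, C k = s)
    (Z : Matrix (Fin r) (Fin r) ℝ)
    (hZsym : Z.IsSymm)
    (hZsparse : ∀ i j, ¬ (G.Adj i j ∨ i = j) → Z i j = 0) :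
    (∃ F : Matrix (Fin r) (Fin r) ℝ, F.PosSemidef ∧
        ∀ i j, (G.Adj i j ∨ i = j) → F i j = Z i j) ↔
      ∀ k : Fin t, (indexMatrix ℝ (C k) * Z * (indexMatrix ℝ (C k))ᵀ).PosSemidef := by
  constructor
  · rintro ⟨F, hF, hFZ⟩ k
    rw [indexMatrix_conj]
    have h := hF.submatrix (fun i => ((C k).orderIsoOfFin rfl i : Fin r))
    convert h using 1
    ext i j
    simp only [Matrix.submatrix_apply]
    symm
    apply hFZ
    by_cases hij : ((C k).orderIsoOfFin rfl i : Fin r) = (C k).orderIsoOfFin rfl j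
    · exact Or.inr hij
    · exact Or.inl ((hmax k).1 (Subtype.prop _) (Subtype.prop _) hij)
  · intro h
    have hcl : ∀ Q : Finset (Fin r), G.IsClique (Q : Set (Fin r)) →
        ∃ x : Fin r → EuclideanSpace ℝ (Fin r), ∀ i ∈ Q, ∀ j ∈ Q,
          inner ℝ (x i) (x j) = Z i j := by
      intro Q hQ
      obtain ⟨s, hQs, hs⟩ := exists_maxClique G Q hQ
      obtain ⟨k, rfl⟩ := hall s hs
      have h1 := (h k).conjTranspose_mul_mul_same (indexMatrix ℝ (C k))
      rw [Matrix.conjTranspose_eq_transpose_of_trivial] at h1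
      obtain ⟨x, hx⟩ := exists_gram _ h1
      refine ⟨x, fun i hi j hj => ?_⟩
      obtain ⟨a, ha⟩ := ((C k).orderIsoOfFin rfl).surjective ⟨i, hQs hi⟩
      obtain ⟨b, hb⟩ := ((C k).orderIsoOfFin rfl).surjective ⟨j, hQs hj⟩
      have ha' : ((C k).orderIsoOfFin rfl a : Fin r) = i := congrArg Subtype.val ha
      have hb' : ((C k).orderIsoOfFin rfl b : Fin r) = j := congrArg Subtype.val hb
      rw [hx, ← ha', ← hb', indexMatrix_lift, indexMatrix_conj]
      rfl
    obtain ⟨x, hx⟩ := gram_completion hchordal Z hcl Finset.univ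
    exact ⟨Matrix.gram ℝ x, Matrix.posSemidef_gram ℝ x, fun i j hij =>
      hx i (Finset.mem_univ _) j (Finset.mem_univ _) hij⟩
end
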